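/- If there exists a non-surjective graph homomorphism from PC_6 to PC_4 such that some vertex of PC_4 has a pre-image of size exactly 6, then there exists a non-surjective graph homomorphism from PC_6 to PC_4 in which no vertex of PC_4 has a pre-image of size exactly 6. -/

import Mathlib

open SimpleGraph

/-- The Cayley graph of the binary group `(ℤ/2ℤ)^n` with connection set `Ω`:
vertices are the vectors, and `u ~ v` iff `u ≠ v` and `u + v ∈ Ω`. -/
def binCayley {n : ℕ} (Ω : Set (Fin n → ZMod 2)) : SimpleGraph (Fin n → ZMod 2) :=
  SimpleGraph.fromRel (fun u v => u + v ∈ Ω)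

/-- The projective cube of dimension `d`: the Cayley graph of `(ℤ/2ℤ)^d` whose
connection set consists of the standard basis vectors together with the all-ones vector. -/
def projCube (d : ℕ) : SimpleGraph (Fin d → ZMod 2) :=
  binCayley ({x | ∃ i, x = Pi.single i 1} ∪ {x | x = fun _ => 1})

open Finset in
/-- A predicate on binary vectors that is preserved by flipping any coordinate in `D` holds on
the whole face through `x` in the directions `D` as soon as it holds at `x`. -/
theorem binVector_face_induction {n : ℕ} (D : Finset (Fin n)) (P : (Fin n → ZMod 2) → Prop)
    {x : Fin n → ZMod 2} (hx : P x) (hP : ∀ y, P y → ∀ d ∈ D, P (y + Pi.single d 1))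
    {y : Fin n → ZMod 2} (hy : ∀ i ∉ D, y i = x i) : P y := by
  have key : ∀ S ⊆ D, P (x + ∑ d ∈ S, Pi.single d 1) := by
    intro S
    induction S using Finset.induction_on with
    | empty => intro _; simpa using hx
    | insert d S hd ih =>
      intro hS
      rw [sum_insert hd, add_comm (Pi.single d 1), ← add_assoc]
      exact hP _ (ih fun i hi => hS (mem_insert_of_mem hi)) d (hS (mem_insert_self d S))
  have h := key (D.filter fun i => y i ≠ x i) (filter_subset _ _)
  convert h using 1
  funext i
  have two : ∀ a b : ZMod 2, a ≠ b → a = b + 1 := by decide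
  by_cases hi : y i = x i
  · simp [Finset.sum_apply, Pi.single_apply, hi]
  · have hD : i ∈ D := by
      by_contra hD
      exact hi (hy i hD)
    simp [Finset.sum_apply, Pi.single_apply, hD, two _ _ hi]

/-- A map between binary cubes sending the edge at `x` in direction `d` to the edge at `F x` in
direction `ℓ x d`. -/
def IsCubeMap {n m : ℕ} (F : (Fin n → ZMod 2) → (Fin m → ZMod 2))
    (ℓ : (Fin n → ZMod 2) → Fin n → Fin m) : Prop :=
  ∀ x d, F (x + Pi.single d 1) = F x + Pi.single (ℓ x d) 1

/-- The face through `x` in the directions `D` is mapped isomorphically onto a face in the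
directions `K`. -/
def IsIsoFace {n m : ℕ} (ℓ : (Fin n → ZMod 2) → Fin n → Fin m) (K : Finset (Fin m))
    (x : Fin n → ZMod 2) (D : Finset (Fin n)) : Prop :=
  Set.BijOn (ℓ x) D K ∧ ∀ y, (∀ i ∉ D, y i = x i) → ∀ d ∈ D, ℓ y d = ℓ x d

/-- The coboundary modulo 2 of a function on the faces of the cube. -/
def faceCoboundary {n : ℕ} (s : (Fin n → ZMod 2) → Finset (Fin n) → ZMod 2)
    (x : Fin n → ZMod 2) (D : Finset (Fin n)) : ZMod 2 :=
  ∑ d ∈ D, (s x (D.erase d) + s (x + Pi.single d 1) (D.erase d))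

open Classical in
/-- The cochain modulo 2 counting the faces that are mapped isomorphically onto a face in the
directions `K`. -/
noncomputable def isoFaceCochain {n m : ℕ} (ℓ : (Fin n → ZMod 2) → Fin n → Fin m)
    (K : Finset (Fin m)) (x : Fin n → ZMod 2) (D : Finset (Fin n)) : ZMod 2 :=
  if IsIsoFace ℓ K x D then 1 else 0

/-- The threshold vector whose entries are `1` exactly from position `t` on. -/
def thresholdVector (n t : ℕ) : Fin n → ZMod 2 := fun i => if t ≤ i then 1 else 0

/-- The base points of the faces of a chain bounding an antipodal sphere. -/
def alternatingBase {n : ℕ} (D : Finset (Fin n)) : Fin n → ZMod 2 :=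
  ∑ d ∈ D, thresholdVector n (d + 1)

theorem thresholdVector_succ {n : ℕ} (d : Fin n) :
    thresholdVector n d = thresholdVector n (d + 1) + Pi.single d 1 := by
  funext i
  simp only [thresholdVector, Pi.add_apply, Pi.single_apply, Fin.ext_iff]
  split_ifs <;> first | omega | simp

theorem binVector_add_add_single {n : ℕ} (x : Fin n → ZMod 2) (d : Fin n) :
    x + Pi.single d 1 + Pi.single d 1 = x := by
  rw [add_assoc, ZModModule.add_self, add_zero]

theorem single_one_inj {m : ℕ} {a b : Fin m}
    (h : (Pi.single a 1 : Fin m → ZMod 2) = Pi.single b 1) : a = b := by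
  by_contra hab
  have := congrFun h a
  simp [hab] at this

section Faces

variable {n m : ℕ} {F : (Fin n → ZMod 2) → (Fin m → ZMod 2)}
  {ℓ : (Fin n → ZMod 2) → Fin n → Fin m} {K : Finset (Fin m)} {x y : Fin n → ZMod 2}
  {D : Finset (Fin n)} {d : Fin n}

theorem IsCubeMap.label_add_single (hF : IsCubeMap F ℓ) (x : Fin n → ZMod 2) (d : Fin n) :
    ℓ (x + Pi.single d 1) d = ℓ x d := by
  have h := hF (x + Pi.single d 1) d
  rw [binVector_add_add_single, hF x d, add_assoc] at h
  have h' := add_eq_zero_iff_eq_neg.mp (left_eq_add.mp h)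
  rw [ZModModule.neg_eq_self] at h'
  exact (single_one_inj h').symm

theorem IsIsoFace.of_mem (h : IsIsoFace ℓ K x D) (hy : ∀ i ∉ D, y i = x i) :
    IsIsoFace ℓ K y D :=
  ⟨h.1.congr fun d hd => (h.2 y hy d hd).symm, fun z hz d hd => by
    rw [h.2 z (fun i hi => (hz i hi).trans (hy i hi)) d hd, h.2 y hy d hd]⟩

theorem add_single_apply_of_notMem (x : Fin n → ZMod 2) (hd : d ∈ D) (i : Fin n) (hi : i ∉ D) :
    (x + Pi.single d 1 : Fin n → ZMod 2) i = x i := by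
  have : i ≠ d := fun h => hi (h ▸ hd)
  simp [this]

theorem isIsoFace_add_single_iff (hd : d ∈ D) :
    IsIsoFace ℓ K (x + Pi.single d 1) D ↔ IsIsoFace ℓ K x D :=
  ⟨fun h => h.of_mem fun i hi => (add_single_apply_of_notMem x hd i hi).symm,
    fun h => h.of_mem (add_single_apply_of_notMem x hd)⟩

theorem IsIsoFace.erase (h : IsIsoFace ℓ K x D) (hd : d ∈ D) :
    IsIsoFace ℓ (K.erase (ℓ x d)) x (D.erase d) := by
  refine ⟨?_, fun y hy g hg => h.2 y (fun i hi => hy i fun hi' => hi (Finset.mem_of_mem_erase hi'))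
    g (Finset.mem_of_mem_erase hg)⟩
  rw [Finset.coe_erase, Finset.coe_erase]
  exact h.1.sdiff_singleton hd

theorem IsIsoFace.apply_eq (h : IsIsoFace ℓ K x D) (hF : IsCubeMap F ℓ) {c : Fin m} (hc : c ∉ K)
    (hy : ∀ i ∉ D, y i = x i) : F y c = F x c := by
  refine (binVector_face_induction D (fun z => (∀ i ∉ D, z i = x i) ∧ F z c = F x c)
    ⟨fun _ _ => rfl, rfl⟩ ?_ hy).2
  rintro z ⟨hz, hzc⟩ d hd
  refine ⟨fun i hi => (add_single_apply_of_notMem z hd i hi).trans (hz i hi), ?_⟩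
  have hne : c ≠ ℓ z d := by
    rw [h.2 z hz d hd]
    rintro rfl
    exact hc (h.1.mapsTo hd)
  simp [hF z d, hne, hzc]

theorem isoFaceCochain_add_single (hd : d ∈ D) :
    isoFaceCochain ℓ K (x + Pi.single d 1) D = isoFaceCochain ℓ K x D := by
  classical
  exact if_congr (isIsoFace_add_single_iff hd) rfl rfl

theorem isoFaceCochain_empty (x : Fin n → ZMod 2) (D : Finset (Fin n)) :
    isoFaceCochain ℓ ∅ x D = if D = ∅ then 1 else 0 := by
  unfold isoFaceCochain
  congr 1
  refine propext ⟨fun h => ?_, ?_⟩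
  · refine Finset.eq_empty_of_forall_notMem fun d hd => ?_
    simpa using h.1.mapsTo hd
  · rintro rfl
    exact ⟨by simp, by simp⟩

theorem faceCoboundary_faceCoboundary (s : (Fin n → ZMod 2) → Finset (Fin n) → ZMod 2)
    (x : Fin n → ZMod 2) (D : Finset (Fin n)) : faceCoboundary (faceCoboundary s) x D = 0 := by
  simp only [faceCoboundary, ← Finset.sum_add_distrib]
  rw [Finset.sum_sigma']
  refine Finset.sum_involution (fun p _ => ⟨p.2, p.1⟩) ?_ ?_ ?_ ?_
  · rintro ⟨d, g⟩ _
    rw [Finset.erase_right_comm, add_right_comm x (Pi.single d 1)]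
    generalize s x _ = a
    generalize s (x + Pi.single d 1) _ = b
    generalize s (x + Pi.single g 1) _ = b'
    generalize s (x + Pi.single g 1 + _) _ = c
    revert a b b' c
    decide
  · rintro ⟨d, g⟩ h _ heq
    simp only [Finset.mem_sigma, Finset.mem_erase] at h
    simp only [Sigma.mk.injEq] at heq
    exact h.2.1 heq.1
  · rintro ⟨d, g⟩ h
    simp only [Finset.mem_sigma, Finset.mem_erase] at h ⊢
    exact ⟨h.2.2, h.2.1.symm, h.1⟩
  · rintro ⟨d, g⟩ _
    rfl

/-- If two opposite facets of a face are mapped isomorphically onto faces in the directions `K`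
that differ in the coordinate `c`, then the face itself is mapped isomorphically. -/
theorem IsIsoFace.insert_of_facets (hF : IsCubeMap F ℓ) {c : Fin m} (hc : c ∉ K) (hd : d ∈ D)
    (h₀ : IsIsoFace ℓ K x (D.erase d)) (h₁ : IsIsoFace ℓ K (x + Pi.single d 1) (D.erase d))
    (hne : F x c ≠ F (x + Pi.single d 1) c) : IsIsoFace ℓ (insert c K) x D := by
  have cross : ∀ y, (∀ i ∉ D.erase d, y i = x i) → ℓ y d = c := by
    intro y hy
    have h := h₁.apply_eq hF hc (y := y + Pi.single d 1) fun i hi => by simp [hy i hi]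
    rw [hF y d, Pi.add_apply, h₀.apply_eq hF hc hy] at h
    by_contra hcl
    simp [Ne.symm hcl] at h
    exact hne h
  have parallel : ∀ g ∈ D.erase d, ℓ (x + Pi.single d 1) g = ℓ x g := by
    intro g hg
    have h := hF (x + Pi.single d 1) g
    rw [add_right_comm, hF (x + Pi.single g 1) d, hF x g, hF x d, cross x fun _ _ => rfl,
      cross _ (add_single_apply_of_notMem x hg), add_right_comm] at h
    exact (single_one_inj (add_left_cancel h)).symm
  have hxd : ℓ x d = c := cross x fun _ _ => rfl
  refine ⟨?_, ?_⟩
  · have h := h₀.1.insert (a := d) (by simpa [hxd] using hc)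
    rwa [hxd, ← Finset.coe_insert, ← Finset.coe_insert, Finset.insert_erase hd] at h
  · intro y hy g hg
    have two : ∀ a b : ZMod 2, a ≠ b → a = b + 1 := by decide
    by_cases hyd : y d = x d
    · have hy' : ∀ i ∉ D.erase d, y i = x i := by
        intro i hi
        by_cases hid : i = d
        · rw [hid, hyd]
        · exact hy i fun hi' => hi (Finset.mem_erase.mpr ⟨hid, hi'⟩)
      by_cases hgd : g = d
      · rw [hgd, cross y hy', hxd]
      · exact h₀.2 y hy' g (Finset.mem_erase.mpr ⟨hgd, hg⟩)
    · have hy' : ∀ i ∉ D.erase d, y i = (x + Pi.single d 1 : Fin n → ZMod 2) i := by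
        intro i hi
        by_cases hid : i = d
        · simp [hid, two _ _ hyd]
        · simp [hid, hy i fun hi' => hi (Finset.mem_erase.mpr ⟨hid, hi'⟩)]
      by_cases hgd : g = d
      · rw [hgd, hxd, ← hF.label_add_single y d]
        refine cross _ fun i hi => ?_
        rw [Pi.add_apply, hy' i hi, ← Pi.add_apply, binVector_add_add_single]
      · have hg' := Finset.mem_erase.mpr ⟨hgd, hg⟩
        rw [h₁.2 y hy' g hg', parallel g hg']

/-- The coboundary of the cochain of `K`-faces, weighted by the coordinate `c`, is the cochain of
`insert c K`-faces. -/
theorem faceCoboundary_isoFaceCochain_mul (hF : IsCubeMap F ℓ) {c : Fin m} (hc : c ∉ K)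
    (hK : faceCoboundary (isoFaceCochain ℓ K) x D = 0) :
    faceCoboundary (fun x D => isoFaceCochain ℓ K x D * F x c) x D =
      isoFaceCochain ℓ (insert c K) x D := by
  classical
  by_cases hg : IsIsoFace ℓ (insert c K) x D
  · obtain ⟨d, hd, hdc⟩ := hg.1.surjOn (Finset.mem_coe.mpr (Finset.mem_insert_self c K))
    have hd : d ∈ D := hd
    have h₀ : IsIsoFace ℓ K x (D.erase d) := by
      simpa [hdc, Finset.erase_insert hc] using hg.erase hd
    have h₁ : IsIsoFace ℓ K (x + Pi.single d 1) (D.erase d) := by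
      have h := ((isIsoFace_add_single_iff hd).mpr hg).erase hd
      simpa [hF.label_add_single, hdc, Finset.erase_insert hc] using h
    rw [faceCoboundary, Finset.sum_eq_single_of_mem d hd]
    · rw [hF x d, hdc]
      simp only [isoFaceCochain, if_pos h₀, if_pos h₁, if_pos hg, Pi.add_apply, Pi.single_eq_same]
      generalize F x c = a
      revert a
      decide
    · intro g hgD hgd
      have hmem : d ∈ D.erase g := Finset.mem_erase.mpr ⟨Ne.symm hgd, hd⟩
      have h₀' : ¬ IsIsoFace ℓ K x (D.erase g) := fun h => hc (hdc ▸ h.1.mapsTo hmem)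
      have h₁' : ¬ IsIsoFace ℓ K (x + Pi.single g 1) (D.erase g) := by
        intro h
        have h' := h.1.mapsTo hmem
        rw [hg.2 _ (add_single_apply_of_notMem x hgD) d hd, hdc] at h'
        exact hc h'
      simp [isoFaceCochain, h₀', h₁']
  · simp only [isoFaceCochain, if_neg hg]
    by_contra hne
    have one : ∀ a : ZMod 2, a ≠ 0 → a = 1 := by decide
    -- every value `b` of the coordinate `c` is taken on some facet that is mapped isomorphically
    have ex : ∀ b : ZMod 2, ∃ d ∈ D, ∃ z : Fin n → ZMod 2, (z = x ∨ z = x + Pi.single d 1) ∧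
        IsIsoFace ℓ K z (D.erase d) ∧ F z c = b := by
      intro b
      by_contra! hb
      have two : ∀ a b : ZMod 2, a ≠ b → a = b + 1 := by decide
      have hterm : ∀ d ∈ D, ∀ z : Fin n → ZMod 2, (z = x ∨ z = x + Pi.single d 1) →
          isoFaceCochain ℓ K z (D.erase d) * F z c =
            isoFaceCochain ℓ K z (D.erase d) * (b + 1) := by
        intro d hd z hz
        by_cases hz' : IsIsoFace ℓ K z (D.erase d)
        · rw [two _ _ (hb d hd z hz hz')]
        · simp [isoFaceCochain, hz']
      apply hne
      calc faceCoboundary (fun x D => isoFaceCochain ℓ K x D * F x c) x D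
          = faceCoboundary (isoFaceCochain ℓ K) x D * (b + 1) := by
            simp only [faceCoboundary, Finset.sum_mul]
            refine Finset.sum_congr rfl fun d hd => ?_
            rw [hterm d hd x (Or.inl rfl), hterm d hd _ (Or.inr rfl), add_mul]
        _ = 0 := by rw [hK, zero_mul]
    obtain ⟨d, hd, z, hz, hzK, hzc⟩ := ex 0
    obtain ⟨g, hgD, w, hw, hwK, hwc⟩ := ex 1
    have hzx : ∀ i ≠ d, z i = x i := by
      rintro i hi
      rcases hz with rfl | rfl <;> simp [hi]
    have hwx : ∀ i ≠ g, w i = x i := by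
      rintro i hi
      rcases hw with rfl | rfl <;> simp [hi]
    by_cases hdg : d = g
    · subst hdg
      have hzw : F z c ≠ F w c := by rw [hzc, hwc]; decide
      rcases hz with rfl | rfl <;> rcases hw with rfl | rfl
      · exact hzw rfl
      · exact hg (hzK.insert_of_facets hF hc hd hwK hzw)
      · exact hg (hwK.insert_of_facets hF hc hd hzK hzw.symm)
      · exact hzw rfl
    · have h₀ := hzK.apply_eq hF hc (y := Function.update z g (w g)) fun i hi => by
        have : i ≠ g := by
          rintro rfl
          exact hi (Finset.mem_erase.mpr ⟨Ne.symm hdg, hgD⟩)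
        simp [this]
      have h₁ := hwK.apply_eq hF hc (y := Function.update z g (w g)) fun i hi => by
        by_cases hig : i = g
        · simp [hig]
        · have hid : i ≠ d := by
            rintro rfl
            exact hi (Finset.mem_erase.mpr ⟨hdg, hd⟩)
          simp [hig, hzx i hid, hwx i hig]
      rw [h₀, hzc, hwc] at h₁
      exact absurd h₁ (by decide)

theorem faceCoboundary_isoFaceCochain (hF : IsCubeMap F ℓ) (K : Finset (Fin m))
    (x : Fin n → ZMod 2) (D : Finset (Fin n)) : faceCoboundary (isoFaceCochain ℓ K) x D = 0 := by
  induction K using Finset.induction_on generalizing x D with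
  | empty =>
    refine Finset.sum_eq_zero fun d _ => ?_
    rw [isoFaceCochain_empty, isoFaceCochain_empty, CharTwo.add_self_eq_zero]
  | insert c K hc ih =>
    have h : isoFaceCochain ℓ (insert c K) =
        faceCoboundary (fun x D => isoFaceCochain ℓ K x D * F x c) := by
      funext y E
      exact (faceCoboundary_isoFaceCochain_mul hF hc (ih y E)).symm
    rw [h, faceCoboundary_faceCoboundary]

/-- The chain based at `alternatingBase` has as boundary the sum of the analogous chain of one
dimension less and its antipode. -/
theorem sum_faceCoboundary_alternatingBase (s : (Fin n → ZMod 2) → Finset (Fin n) → ZMod 2)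
    (hs : ∀ x D, ∀ d ∈ D, s (x + Pi.single d 1) D = s x D) :
    ∑ D : Finset (Fin n), faceCoboundary s (alternatingBase D) D =
      ∑ D : Finset (Fin n), (s (alternatingBase D) D + s (alternatingBase D + 1) D) := by
  have reindex : ∑ D : Finset (Fin n), faceCoboundary s (alternatingBase D) D =
      ∑ D : Finset (Fin n), ∑ d ∈ Dᶜ, (s (alternatingBase D + thresholdVector n (d + 1)) D +
        s (alternatingBase D + thresholdVector n d) D) := by
    simp only [faceCoboundary]
    rw [Finset.sum_sigma', Finset.sum_sigma']
    refine Finset.sum_bij' (fun p _ => ⟨p.1.erase p.2, p.2⟩) (fun p _ => ⟨insert p.2 p.1, p.2⟩)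
      ?_ ?_ ?_ ?_ ?_
    · rintro ⟨D, d⟩ h
      simp
    · rintro ⟨D, d⟩ h
      simp
    · rintro ⟨D, d⟩ h
      simp only [Finset.mem_sigma, Finset.mem_univ, true_and] at h
      simp [Finset.insert_erase h]
    · rintro ⟨D, d⟩ h
      simp only [Finset.mem_sigma, Finset.mem_univ, true_and, Finset.mem_compl] at h
      simp [Finset.erase_insert h]
    · rintro ⟨D, d⟩ h
      simp only [Finset.mem_sigma, Finset.mem_univ, true_and] at h
      have hb : alternatingBase D =
          alternatingBase (D.erase d) + thresholdVector n (d + 1) := by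
        simp only [alternatingBase, Finset.sum_erase_add _ _ h]
      simp only [thresholdVector_succ d, ← add_assoc, ← hb]
  rw [reindex]
  refine Finset.sum_congr rfl fun D _ => ?_
  set b := alternatingBase D
  have extend : ∑ d ∈ Dᶜ, (s (b + thresholdVector n (d + 1)) D + s (b + thresholdVector n d) D) =
      ∑ d : Fin n, (s (b + thresholdVector n (d + 1)) D + s (b + thresholdVector n d) D) := by
    refine Finset.sum_subset (Finset.subset_univ _) fun d _ hd => ?_
    have hd' : d ∈ D := by simpa using hd
    rw [thresholdVector_succ d, ← add_assoc, hs _ _ d hd', CharTwo.add_self_eq_zero]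
  have telescope : ∀ (g : ℕ → ZMod 2) (N : ℕ),
      ∑ t ∈ Finset.range N, (g (t + 1) + g t) = g N + g 0 := by
    intro g N
    simpa only [CharTwo.sub_eq_add] using Finset.sum_range_sub g N
  have hzero : thresholdVector n 0 = 1 := by
    funext i
    simp [thresholdVector]
  have hlast : thresholdVector n n = 0 := by
    funext i
    simp [thresholdVector]
  rw [extend, Fin.sum_univ_eq_sum_range
    (fun t => s (b + thresholdVector n (t + 1)) D + s (b + thresholdVector n t) D) n,
    telescope (fun t => s (b + thresholdVector n t) D), hzero, hlast, add_zero]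

/-- A cube map commuting with the antipodal maps maps an odd number of the faces based at
`alternatingBase` isomorphically onto faces in the directions `K`. -/
theorem IsCubeMap.sum_isoFaceCochain (hF : IsCubeMap F ℓ) (hanti : ∀ x, F (x + 1) = F x + 1)
    (K : Finset (Fin m)) :
    ∑ D : Finset (Fin n), isoFaceCochain ℓ K (alternatingBase D) D = 1 := by
  have label_antipode : ∀ x, ℓ (x + 1) = ℓ x := by
    intro x
    funext d
    have h := hF (x + 1) d
    rw [add_right_comm, hanti, hanti, hF, add_right_comm] at h
    exact (single_one_inj (add_left_cancel h)).symm
  have cochain_antipode : ∀ K x D, isoFaceCochain ℓ K (x + 1) D = isoFaceCochain ℓ K x D := by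
    have imp : ∀ K x D, IsIsoFace ℓ K x D → IsIsoFace ℓ K (x + 1) D := by
      intro K x D h
      refine ⟨by rw [label_antipode]; exact h.1, fun y hy d hd => ?_⟩
      rw [label_antipode, ← label_antipode y]
      refine h.2 _ (fun i hi => ?_) d hd
      rw [Pi.add_apply, hy i hi, ← Pi.add_apply, add_assoc, ZModModule.add_self, add_zero]
    intro K x D
    have iff : IsIsoFace ℓ K (x + 1) D ↔ IsIsoFace ℓ K x D := by
      refine ⟨fun h => ?_, imp K x D⟩
      simpa only [add_assoc, ZModModule.add_self, add_zero] using imp K _ D h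
    classical
    exact if_congr iff rfl rfl
  induction K using Finset.induction_on with
  | empty => simp [isoFaceCochain_empty]
  | insert c K hc ih =>
    have inv : ∀ x D, ∀ d ∈ D, isoFaceCochain ℓ K (x + Pi.single d 1) D * F (x + Pi.single d 1) c =
        isoFaceCochain ℓ K x D * F x c := by
      intro x D d hd
      rw [isoFaceCochain_add_single hd]
      by_cases h : IsIsoFace ℓ K x D
      · rw [h.apply_eq hF hc (add_single_apply_of_notMem x hd)]
      · simp [isoFaceCochain, h]
    have h := sum_faceCoboundary_alternatingBase (fun x D => isoFaceCochain ℓ K x D * F x c) inv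
    simp only [faceCoboundary_isoFaceCochain_mul hF hc (faceCoboundary_isoFaceCochain hF K _ _),
      cochain_antipode, hanti, ← mul_add, Pi.add_apply, Pi.one_apply, ← add_assoc,
      CharTwo.add_self_eq_zero, zero_add, mul_one] at h
    rw [h, ih]

/-- A cube map commuting with the antipodal maps is surjective. -/
theorem IsCubeMap.surjective (hF : IsCubeMap F ℓ) (hanti : ∀ x, F (x + 1) = F x + 1) :
    Function.Surjective F := by
  obtain ⟨D, -, hD⟩ := Finset.exists_ne_zero_of_sum_ne_zero
    ((hF.sum_isoFaceCochain hanti Finset.univ).trans_ne one_ne_zero)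
  have h : IsIsoFace ℓ Finset.univ (alternatingBase D) D := by
    by_contra h
    exact hD (by simp [isoFaceCochain, h])
  intro z
  obtain ⟨y, -, hy⟩ := binVector_face_induction Finset.univ
    (fun w => ∃ y, (∀ i ∉ D, y i = alternatingBase D i) ∧ F y = w)
    (x := F (alternatingBase D)) ⟨_, fun _ _ => rfl, rfl⟩ (by
      rintro _ ⟨y, hy, rfl⟩ j -
      obtain ⟨d, hd, rfl⟩ := (h.of_mem hy).1.surjOn (Finset.mem_coe.mpr (Finset.mem_univ j))
      exact ⟨y + Pi.single d 1,
        fun i hi => (add_single_apply_of_notMem y hd i hi).trans (hy i hi), hF y d⟩)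
    (y := z) (by simp)
  exact ⟨y, hy⟩

end Faces

theorem projCube_hom_step {n m : ℕ} (f : projCube n →g projCube m) (hn : n ≠ 0)
    (u s : Fin n → ZMod 2) (hs : (∃ i, s = Pi.single i 1) ∨ s = 1) :
    (∃ j, f (u + s) = f u + Pi.single j 1) ∨ f (u + s) = f u + 1 := by
  have hs0 : s ≠ 0 := by
    have : Nonempty (Fin n) := ⟨⟨0, Nat.pos_of_ne_zero hn⟩⟩
    rcases hs with ⟨i, rfl⟩ | rfl
    · simp
    · exact one_ne_zero
  have cancel : ∀ {k : ℕ} (a b : Fin k → ZMod 2), a + (a + b) = b := by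
    intro k a b
    rw [← add_assoc, ZModModule.add_self, zero_add]
  have hadj : (projCube n).Adj u (u + s) := by
    refine (SimpleGraph.fromRel_adj _ _ _).mpr ⟨by simpa using hs0, Or.inl ?_⟩
    rw [cancel]
    exact hs
  have h := ((SimpleGraph.fromRel_adj _ _ _).mp (f.map_adj hadj)).2
  rw [add_comm (f (u + s)), or_self] at h
  rcases h with ⟨j, hj⟩ | hj
  · exact Or.inl ⟨j, by rw [← hj, cancel]⟩
  · exact Or.inr ((cancel (f u) (f (u + s))).symm.trans (congrArg (f u + ·) hj))

/-- Every homomorphism between projective cubes of even dimensions is surjective. -/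
theorem projCube_hom_surjective {n m : ℕ} (hn : Even n) (hn0 : n ≠ 0) (hm : Even m)
    (f : projCube n →g projCube m) : Function.Surjective f := by
  have hn2 : (n : ZMod 2) = 0 := (ZMod.natCast_eq_zero_iff_even).mpr hn
  have hm2 : (m : ZMod 2) = 0 := (ZMod.natCast_eq_zero_iff_even).mpr hm
  let p : (Fin (n + 1) → ZMod 2) → Fin n → ZMod 2 := fun x i => x i.castSucc + x (Fin.last n)
  let q : (Fin (n + 1) → ZMod 2) → ZMod 2 := fun x => ∑ i, x i + ∑ j, f (p x) j
  let F : (Fin (n + 1) → ZMod 2) → Fin (m + 1) → ZMod 2 := fun x =>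
    Fin.snoc (α := fun _ => ZMod 2) (fun j => f (p x) j + q x) (q x)
  have hp_one : ∀ x, p (x + 1) = p x := by
    intro x
    funext i
    simp only [p, Pi.add_apply, Pi.one_apply]
    rw [add_add_add_comm, CharTwo.add_self_eq_zero, add_zero]
  have hp_single : ∀ x d, ∃ s : Fin n → ZMod 2,
      ((∃ i, s = Pi.single i 1) ∨ s = 1) ∧ p (x + Pi.single d 1) = p x + s := by
    intro x d
    induction d using Fin.lastCases with
    | last =>
      refine ⟨1, Or.inr rfl, ?_⟩
      funext i
      simp [p, (Fin.castSucc_lt_last i).ne, add_assoc]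
    | cast d =>
      refine ⟨Pi.single d 1, Or.inl ⟨d, rfl⟩, ?_⟩
      funext i
      simp [p, Pi.single_apply, (Fin.castSucc_lt_last d).ne', add_right_comm]
  have hF_one : ∀ x, F (x + 1) = F x + 1 := by
    intro x
    have hq : q (x + 1) = q x + 1 := by
      simp only [q, hp_one, Pi.add_apply, Pi.one_apply, Finset.sum_add_distrib]
      simp [hn2, add_right_comm]
    funext j
    induction j using Fin.lastCases with
    | last => simp [F, hq]
    | cast j => simp [F, hq, hp_one, add_assoc]
  have hF_single : ∀ x d, ∃ j, F (x + Pi.single d 1) = F x + Pi.single j 1 := by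
    intro x d
    obtain ⟨s, hs, hps⟩ := hp_single x d
    rcases projCube_hom_step f hn0 (p x) s hs with ⟨j, hj⟩ | hj
    · have hq : q (x + Pi.single d 1) = q x := by
        simp only [q, hps, hj, Pi.add_apply, Finset.sum_add_distrib]
        rw [add_add_add_comm, Fintype.sum_pi_single', Fintype.sum_pi_single',
          CharTwo.add_self_eq_zero, add_zero]
      refine ⟨j.castSucc, ?_⟩
      funext k
      induction k using Fin.lastCases with
      | last => simp [F, hq, (Fin.castSucc_lt_last j).ne']
      | cast k => simp [F, hq, hps, hj, Pi.single_apply, add_right_comm]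
    · have hq : q (x + Pi.single d 1) = q x + 1 := by
        simp only [q, hps, hj, Pi.add_apply, Pi.one_apply, Finset.sum_add_distrib]
        simp [hm2, add_right_comm]
      refine ⟨Fin.last m, ?_⟩
      funext k
      induction k using Fin.lastCases with
      | last => simp [F, hq]
      | cast k =>
        simp only [F, hq, hps, hj, Fin.snoc_castSucc, Pi.add_apply, Pi.one_apply]
        rw [add_add_add_comm, CharTwo.add_self_eq_zero, Pi.single_eq_of_ne
          (Fin.castSucc_lt_last k).ne]
  choose ℓ hℓ using hF_single
  intro y
  obtain ⟨x, hx⟩ := IsCubeMap.surjective (F := F) (ℓ := ℓ) hℓ hF_one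
    (Fin.snoc (α := fun _ => ZMod 2) y 0)
  have hq : q x = 0 := by simpa [F] using congrFun hx (Fin.last m)
  refine ⟨p x, ?_⟩
  funext j
  simpa [F, hq] using congrFun hx j.castSucc

/-- If there is a non-surjective homomorphism `PC_6 → PC_4` in which some vertex
has exactly `6` pre-images, then there is a non-surjective homomorphism
`PC_6 → PC_4` in which no vertex has exactly `6` pre-images. -/
theorem projCube_hom_remove_fibers_of_six
    (h : ∃ f : projCube 6 →g projCube 4, ¬ Function.Surjective f ∧
      ∃ x : Fin 4 → ZMod 2, (⇑f ⁻¹' {x}).ncard = 6) :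
    ∃ g : projCube 6 →g projCube 4, ¬ Function.Surjective g ∧
      ∀ x : Fin 4 → ZMod 2, (⇑g ⁻¹' {x}).ncard ≠ 6 := by
  obtain ⟨f, hf, -⟩ := h
  exact absurd (projCube_hom_surjective (by decide) (by decide) (by decide) f) hf
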